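/- The linear operator field L(x,y,z) = [[x,−y,0],[y,x,0],[0,0,z]] on ℝ³ is a Nijenhuis operator; the coefficients of its characteristic polynomial are σ₁ = −2x−z, σ₂ = x²+y²+2xz, σ₃ = −x²z−y²z, and these three polynomials are algebraically independent over ℝ. Consequently the algebra 𝔠₅⁻⊕𝔡 with relations η₁⋆η₁ = η₁, η₁⋆η₂ = η₂, η₂⋆η₁ = η₂, η₂⋆η₂ = −η₁, η₃⋆η₃ = η₃ (other products zero) is a differentially non-degenerate LSA. -/

import Mathlib

open Matrix

/-- Components `N^i_{jk}` of the Nijenhuis torsion of a matrix-valued operator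
field `L` on `ℝⁿ` (with `L x i j = L^i_j(x)`). -/
noncomputable def nijTorsion {n : ℕ} (L : (Fin n → ℝ) → Matrix (Fin n) (Fin n) ℝ)
    (x : Fin n → ℝ) (i j k : Fin n) : ℝ :=
  ∑ s : Fin n,
    (L x s j * fderiv ℝ (fun y => L y i k) x (Pi.single s 1)
      - L x s k * fderiv ℝ (fun y => L y i j) x (Pi.single s 1)
      - L x i s * fderiv ℝ (fun y => L y s k) x (Pi.single j 1)
      + L x i s * fderiv ℝ (fun y => L y s j) x (Pi.single k 1))

/-- `L` is a Nijenhuis operator: its Nijenhuis torsion vanishes identically. -/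
def IsNijenhuis {n : ℕ} (L : (Fin n → ℝ) → Matrix (Fin n) (Fin n) ℝ) : Prop :=
  ∀ x i j k, nijTorsion L x i j k = 0

/-- Bilinear product on `ℝⁿ` with structure constants `a i j k`
(`ηᵢ ⋆ ηⱼ = ∑ₖ a i j k • ηₖ`). -/
def mulSC {n : ℕ} (a : Fin n → Fin n → Fin n → ℝ) (ξ η : Fin n → ℝ) : Fin n → ℝ :=
  fun k => ∑ i : Fin n, ∑ j : Fin n, a i j k * ξ i * η j

/-- Left-symmetry: the associator is symmetric in its first two arguments. -/
def IsLSA {n : ℕ} (a : Fin n → Fin n → Fin n → ℝ) : Prop :=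
  ∀ ξ η ζ : Fin n → ℝ,
    mulSC a (mulSC a ξ η) ζ - mulSC a ξ (mulSC a η ζ)
      = mulSC a (mulSC a η ξ) ζ - mulSC a η (mulSC a ξ ζ)

/-- The right-adjoint operator field of the algebra with structure constants `a`:
`(R x) k i = ∑ j, a i j k * x j`, i.e. `(R x).mulVec ξ = ξ ⋆ x`. -/
def rightAdj {n : ℕ} (a : Fin n → Fin n → Fin n → ℝ) (x : Fin n → ℝ) :
    Matrix (Fin n) (Fin n) ℝ :=
  Matrix.of fun k i => ∑ j : Fin n, a i j k * x j

/-- `charCoeff L i` is the coefficient `σ_{i+1}` of `t^(n-1-i)` in the characteristic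
polynomial `χ_{L(x)}(t) = tⁿ + σ₁(x) tⁿ⁻¹ + ⋯ + σₙ(x)` of `L(x)`. -/
noncomputable def charCoeff {n : ℕ} (L : (Fin n → ℝ) → Matrix (Fin n) (Fin n) ℝ)
    (i : Fin n) : (Fin n → ℝ) → ℝ :=
  fun x => (L x).charpoly.coeff (n - 1 - (i : ℕ))

/-- A (structure-constant) algebra is differentially non-degenerate if the coefficients
of the characteristic polynomial of its right-adjoint operator are algebraically
independent over `ℝ` (as elements of the algebra of real-valued functions). -/
def DiffNonDeg {n : ℕ} (a : Fin n → Fin n → Fin n → ℝ) : Prop :=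
  AlgebraicIndependent ℝ (charCoeff (rightAdj a))

/-- Isomorphism of the algebras on `ℝⁿ` with structure constants `a` and `b`. -/
def AlgIsoSC {n : ℕ} (a b : Fin n → Fin n → Fin n → ℝ) : Prop :=
  ∃ φ : (Fin n → ℝ) ≃ₗ[ℝ] (Fin n → ℝ),
    ∀ ξ η : Fin n → ℝ, φ (mulSC a ξ η) = mulSC b (φ ξ) (φ η)

/-- Jacobi matrix of a family of functions `σ` on `ℝⁿ`: `J i j = ∂σᵢ/∂xⱼ`. -/
noncomputable def jacobiMat {n : ℕ} (σ : Fin n → (Fin n → ℝ) → ℝ) (x : Fin n → ℝ) :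
    Matrix (Fin n) (Fin n) ℝ :=
  Matrix.of fun i j => fderiv ℝ (σ i) x (Pi.single j 1)

/-- Companion-type matrix with first column `(-s 0, …, -s (n-1))ᵀ`, ones on the
superdiagonal and zeros elsewhere. -/
def companionS {n : ℕ} (s : Fin n → ℝ) : Matrix (Fin n) (Fin n) ℝ :=
  Matrix.of fun i j => if (j : ℕ) = 0 then -s i else if (j : ℕ) = (i : ℕ) + 1 then 1 else 0

/-- The operator field of the 𝔠₅⁻⊕𝔡. -/
def Lop (x : Fin 3 → ℝ) : Matrix (Fin 3) (Fin 3) ℝ :=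
  Matrix.of ![![x 0, -x 1, 0], ![x 1, x 0, 0], ![0, 0, x 2]]

/-- Structure constants of the 𝔠₅⁻⊕𝔡. -/
def sc : Fin 3 → Fin 3 → Fin 3 → ℝ :=
  ![![![1,0,0], ![0,1,0], ![0,0,0]],
    ![![0,1,0], ![-1,0,0], ![0,0,0]],
    ![![0,0,0], ![0,0,0], ![0,0,1]]]

theorem charpoly_Lop (x : Fin 3 → ℝ) :
    (Lop x).charpoly = Polynomial.X ^ 3 + Polynomial.C (-2 * x 0 - x 2) * Polynomial.X ^ 2
      + Polynomial.C (x 0 ^ 2 + x 1 ^ 2 + 2 * x 0 * x 2) * Polynomial.X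
      + Polynomial.C (-(x 0 ^ 2 * x 2) - x 1 ^ 2 * x 2) := by
  simp only [Matrix.charpoly, Matrix.det_fin_three, Matrix.charmatrix_apply, Lop]
  simp [Matrix.diagonal]
  have h2 : (Polynomial.C (2 : ℝ)) = 2 := rfl
  rw [h2]
  ring

theorem charCoeff_Lop : charCoeff Lop =
    ![(fun x : Fin 3 → ℝ => -2 * x 0 - x 2),
      (fun x : Fin 3 → ℝ => x 0 ^ 2 + x 1 ^ 2 + 2 * x 0 * x 2),
      (fun x : Fin 3 → ℝ => -(x 0 ^ 2 * x 2) - x 1 ^ 2 * x 2)] := by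
  funext i x
  rw [charCoeff, charpoly_Lop]
  fin_cases i <;>
    simp [Polynomial.coeff_X, Polynomial.coeff_C, Polynomial.coeff_X_pow,
      -map_add, -map_sub, -map_mul, -map_neg]

theorem isNijenhuis_Lop : IsNijenhuis Lop := by
  have h (l : Fin 3) (x v : Fin 3 → ℝ) : fderiv ℝ (fun y : Fin 3 → ℝ => y l) x v = v l := by
    rw [(hasFDerivAt_apply l x).fderiv]; rfl
  intro x i j k
  fin_cases i <;> fin_cases j <;> fin_cases k <;>
    simp [nijTorsion, Lop, Fin.sum_univ_three, h]

theorem rightAdj_sc : rightAdj sc = Lop := by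
  funext x
  ext i j
  fin_cases i <;> fin_cases j <;> simp [rightAdj, sc, Lop, Fin.sum_univ_three]

theorem isLSA_sc : IsLSA sc := by
  intro ξ η ζ
  funext k
  fin_cases k <;> simp [mulSC, sc, Fin.sum_univ_three] <;> ring

/-- A cubic with coefficients in `[0, 1] × [1, 2] × [0, 1]` is the characteristic polynomial of
some value of `Lop`. -/
theorem exists_charCoeff_eq {a b c : ℝ} (ha : a ∈ Set.Icc (0 : ℝ) 1) (hb : b ∈ Set.Icc (1 : ℝ) 2)
    (hc : c ∈ Set.Icc (0 : ℝ) 1) :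
    ∃ x y z : ℝ, -2 * x - z = a ∧ x ^ 2 + y ^ 2 + 2 * x * z = b ∧
      -(x ^ 2 * z) - y ^ 2 * z = c := by
  obtain ⟨ha0, ha1⟩ := ha
  obtain ⟨hb1, hb2⟩ := hb
  obtain ⟨hc0, hc1⟩ := hc
  obtain ⟨z, -, hz⟩ : (0 : ℝ) ∈ (fun t : ℝ => t ^ 3 + a * t ^ 2 + b * t + c) '' Set.Icc (-1) 0 :=
    intermediate_value_Icc (by norm_num) (by fun_prop)
      ⟨by norm_num; linarith, by norm_num; linarith⟩
  have hz' : z ^ 3 + a * z ^ 2 + b * z + c = 0 := hz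
  have hy : 0 ≤ b + a * z + z ^ 2 - ((a + z) / 2) ^ 2 := by
    nlinarith [sq_nonneg (3 * z + a)]
  refine ⟨-(a + z) / 2, √(b + a * z + z ^ 2 - ((a + z) / 2) ^ 2), z, by ring, ?_, ?_⟩
  · rw [Real.sq_sqrt hy]; ring
  · rw [Real.sq_sqrt hy]; linear_combination -hz'

theorem algebraicIndependent_charCoeff_Lop : AlgebraicIndependent ℝ (charCoeff Lop) := by
  rw [algebraicIndependent_iff]
  intro p hp
  refine MvPolynomial.funext_set
    ![Set.Icc (0 : ℝ) 1, Set.Icc (1 : ℝ) 2, Set.Icc (0 : ℝ) 1] ?_ ?_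
  · intro i
    fin_cases i <;> exact Set.Icc_infinite (by norm_num)
  · intro s hs
    obtain ⟨x, y, z, h0, h1, h2⟩ := exists_charCoeff_eq
      (hs 0 (Set.mem_univ _)) (hs 1 (Set.mem_univ _)) (hs 2 (Set.mem_univ _))
    have hs' : s = fun i => charCoeff Lop i ![x, y, z] := by
      rw [charCoeff_Lop]
      funext i
      fin_cases i
      · exact h0.symm
      · exact h1.symm
      · exact h2.symm
    have h := congrArg (Pi.evalAlgHom ℝ (fun _ : Fin 3 → ℝ => ℝ) ![x, y, z]) hp
    rw [MvPolynomial.comp_aeval_apply] at h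
    rw [hs', map_zero, ← MvPolynomial.coe_aeval_eq_eval]
    exact h

/-- The operator field is a Nijenhuis operator; the coefficients of its
characteristic polynomial are the stated polynomials, which are algebraically
independent over `ℝ`; it is the right-adjoint operator of the stated algebra,
which is consequently a differentially non-degenerate LSA. -/
theorem stmt11 :
    IsNijenhuis Lop ∧
    (∀ x : Fin 3 → ℝ, charCoeff Lop 0 x = -2 * x 0 - x 2) ∧
    (∀ x : Fin 3 → ℝ, charCoeff Lop 1 x = x 0 ^ 2 + x 1 ^ 2 + 2 * x 0 * x 2) ∧
    (∀ x : Fin 3 → ℝ, charCoeff Lop 2 x = -(x 0 ^ 2 * x 2) - x 1 ^ 2 * x 2) ∧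
    AlgebraicIndependent ℝ
      ![(fun x : Fin 3 → ℝ => -2 * x 0 - x 2),
        (fun x : Fin 3 → ℝ => x 0 ^ 2 + x 1 ^ 2 + 2 * x 0 * x 2),
        (fun x : Fin 3 → ℝ => -(x 0 ^ 2 * x 2) - x 1 ^ 2 * x 2)] ∧
    rightAdj sc = Lop ∧ IsLSA sc ∧ DiffNonDeg sc := by
  have h := algebraicIndependent_charCoeff_Lop
  refine ⟨isNijenhuis_Lop, fun x => ?_, fun x => ?_, fun x => ?_, charCoeff_Lop ▸ h,
    rightAdj_sc, isLSA_sc, ?_⟩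
  · rw [charCoeff_Lop]; rfl
  · rw [charCoeff_Lop]; rfl
  · rw [charCoeff_Lop]; rfl
  · rwa [DiffNonDeg, rightAdj_sc]
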